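/- arXiv:1412.2147 — 2 statements merged into one kernel-verified Lean document; each statement's English description precedes it below -/
import Mathlib

section
/- Let R ⊆ T(V)_{(2)} be a graded subspace such that the two-sided ideal ⟨R⟩ it generates is also a coideal of the tensor bialgebra T(V), and let B = T(V)/⟨R⟩ be the quotient graded bialgebra. Suppose ℓ < 0 and every homogeneous linear map R → P(B) of degree ℓ is zero. Then every truncated bialgebra 2-cocycle of degree ℓ on B is a truncated 2-coboundary. -/
/-!
STATEMENT 9: Let R ⊆ T(V)_{(2)} be a graded subspace such that the two-sided ideal ⟨R⟩
is also a coideal of the tensor bialgebra T(V), and let B = T(V)/⟨R⟩ be the quotient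
graded bialgebra.  Suppose ℓ < 0 and every homogeneous linear map R → P(B) of degree ℓ
is zero.  Then every truncated bialgebra 2-cocycle of degree ℓ on B is a truncated
2-coboundary.
-/

open TensorProduct

namespace Rigidity

noncomputable section

variable (k V : Type*) [Field k] [AddCommGroup V] [Module k V]

/-- The `n`-th graded component `V^{⊗n}` of the tensor algebra `T(V)`. -/
def tgrade (n : ℕ) : Submodule k (TensorAlgebra k V) :=
  LinearMap.range (TensorAlgebra.ι k : V →ₗ[k] TensorAlgebra k V) ^ n

/-- `T(V)_{(2)} = ⊕_{n ≥ 2} V^{⊗n}`. -/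
def Ttwo : Submodule k (TensorAlgebra k V) := ⨆ n : ℕ, tgrade k V (n + 2)

/-- The linear map `v ↦ ι(v) ⊗ 1 + 1 ⊗ ι(v)`. -/
def diagV : V →ₗ[k] TensorAlgebra k V ⊗[k] TensorAlgebra k V :=
  ((TensorProduct.mk k (TensorAlgebra k V) (TensorAlgebra k V)).flip 1) ∘ₗ TensorAlgebra.ι k
    + (TensorProduct.mk k (TensorAlgebra k V) (TensorAlgebra k V) 1) ∘ₗ TensorAlgebra.ι k

/-- The comultiplication of the tensor bialgebra `T(V)`, i.e. the unique algebra map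
`T(V) → T(V) ⊗ T(V)` with `Δ(v) = v ⊗ 1 + 1 ⊗ v` for `v ∈ V`. -/
def comulT : TensorAlgebra k V →ₗ[k] TensorAlgebra k V ⊗[k] TensorAlgebra k V :=
  (TensorAlgebra.lift k (diagV k V)).toLinearMap

/-- The counit of the tensor bialgebra `T(V)`. -/
def counitT : TensorAlgebra k V →ₗ[k] k :=
  (TensorAlgebra.lift k (0 : V →ₗ[k] k)).toLinearMap

variable (B : Type*) [Ring B] [Bialgebra k B]

/-- The augmentation ideal `B⁺ = ker ε` of the bialgebra `B`. -/
def Bplus : Submodule k B := LinearMap.ker (Coalgebra.counit (R := k) (A := B))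

/-- The subspace `B⁺ ⊗ B⁺` of `B ⊗ B`. -/
def BpBp : Submodule k (B ⊗[k] B) :=
  LinearMap.range (TensorProduct.map (Bplus k B).subtype (Bplus k B).subtype)

variable (ℬ : ℕ → Submodule k B)

/-- The degree-`n` component `(B ⊗ B)_n = ⊕_{i+j=n} B_i ⊗ B_j` of `B ⊗ B`. -/
def tensorGrade (n : ℕ) : Submodule k (B ⊗[k] B) :=
  ⨆ (ij : ℕ × ℕ) (_ : ij.1 + ij.2 = n),
    LinearMap.range (TensorProduct.map (ℬ ij.1).subtype (ℬ ij.2).subtype)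

/-- The grading of `B` reindexed by `ℤ` (with `⊥` in negative degrees). -/
def gradeZ (z : ℤ) : Submodule k B := if 0 ≤ z then ℬ z.toNat else ⊥

/-- The grading of `B ⊗ B` reindexed by `ℤ` (with `⊥` in negative degrees). -/
def tensorGradeZ (z : ℤ) : Submodule k (B ⊗[k] B) :=
  if 0 ≤ z then tensorGrade k B ℬ z.toNat else ⊥

/-- `f : B ⊗ B → B` is homogeneous of degree `ℓ`. -/
def HomogF (ℓ : ℤ) (f : B ⊗[k] B →ₗ[k] B) : Prop :=
  ∀ (n : ℕ) (u : B ⊗[k] B), u ∈ tensorGrade k B ℬ n → f u ∈ gradeZ k B ℬ (n + ℓ)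

/-- `g : B → B ⊗ B` is homogeneous of degree `ℓ`. -/
def HomogG (ℓ : ℤ) (g : B →ₗ[k] B ⊗[k] B) : Prop :=
  ∀ (n : ℕ) (x : B), x ∈ ℬ n → g x ∈ tensorGradeZ k B ℬ (n + ℓ)

/-- `s : B → B` is homogeneous of degree `ℓ`. -/
def HomogE (ℓ : ℤ) (s : B →ₗ[k] B) : Prop :=
  ∀ (n : ℕ) (x : B), x ∈ ℬ n → s x ∈ gradeZ k B ℬ (n + ℓ)

/-- The comultiplication of the bialgebra `B ⊗ B`:
`a ⊗ b ↦ (a₍₁₎ ⊗ b₍₁₎) ⊗ (a₍₂₎ ⊗ b₍₂₎)`. -/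
def comul2 : B ⊗[k] B →ₗ[k] (B ⊗[k] B) ⊗[k] (B ⊗[k] B) :=
  (TensorProduct.tensorTensorTensorComm k B B B B).toLinearMap ∘ₗ
    TensorProduct.map Coalgebra.comul Coalgebra.comul

/-- `(f, g)` is a truncated bialgebra 2-cocycle of degree `ℓ` on the graded
bialgebra `B` (with grading `ℬ`).  Here `f : B⁺ ⊗ B⁺ → B⁺` and `g : B⁺ → B⁺ ⊗ B⁺`
are modelled as maps on `B ⊗ B` resp. `B` via the extensions
`f(1 ⊗ a) = f(a ⊗ 1) = 0` and `g(1) = 0`. -/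
def IsTruncCocycle (ℓ : ℤ) (f : B ⊗[k] B →ₗ[k] B) (g : B →ₗ[k] B ⊗[k] B) : Prop :=
  (∀ a : B, f ((1 : B) ⊗ₜ[k] a) = 0) ∧ (∀ a : B, f (a ⊗ₜ[k] (1 : B)) = 0) ∧
  (∀ u : B ⊗[k] B, f u ∈ Bplus k B) ∧
  g 1 = 0 ∧ (∀ x : B, g x ∈ BpBp k B) ∧
  HomogF k B ℬ ℓ f ∧ HomogG k B ℬ ℓ g ∧
  -- (i) the Hochschild cocycle condition:
  (∀ a b c : B, a ∈ Bplus k B → b ∈ Bplus k B → c ∈ Bplus k B →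
    a * f (b ⊗ₜ[k] c) + f (a ⊗ₜ[k] (b * c)) = f ((a * b) ⊗ₜ[k] c) + f (a ⊗ₜ[k] b) * c) ∧
  -- (ii) the coalgebra cocycle condition:
  (∀ c : B, c ∈ Bplus k B →
    LinearMap.lTensor B g (Coalgebra.comul c) + LinearMap.lTensor B Coalgebra.comul (g c)
      = TensorProduct.assoc k B B B (LinearMap.rTensor B Coalgebra.comul (g c))
        + TensorProduct.assoc k B B B (LinearMap.rTensor B g (Coalgebra.comul c))) ∧
  -- (iii) the compatibility condition:
  (∀ a b : B, a ∈ Bplus k B → b ∈ Bplus k B →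
    TensorProduct.map f (LinearMap.mul' k B) (comul2 k B (a ⊗ₜ[k] b))
      + TensorProduct.map (LinearMap.mul' k B) f (comul2 k B (a ⊗ₜ[k] b))
      - Coalgebra.comul (f (a ⊗ₜ[k] b))
      = -(Coalgebra.comul (R := k) a * g b) + g (a * b) - g a * Coalgebra.comul (R := k) b)


/-- `(f, g)` is a truncated bialgebra 2-coboundary of degree `ℓ`. -/
def IsTruncCoboundary (ℬ : ℕ → Submodule k B) (ℓ : ℤ)
    (f : B ⊗[k] B →ₗ[k] B) (g : B →ₗ[k] B ⊗[k] B) : Prop :=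
  ∃ s : B →ₗ[k] B, s 1 = 0 ∧ (∀ x : B, s x ∈ Bplus k B) ∧ HomogE k B ℬ ℓ s ∧
    (∀ a b : B, a ∈ Bplus k B → b ∈ Bplus k B →
      f (a ⊗ₜ[k] b) = a * s b - s (a * b) + s a * b) ∧
    (∀ c : B, c ∈ Bplus k B →
      g c = -(LinearMap.lTensor B s (Coalgebra.comul c)) + Coalgebra.comul (s c)
        - LinearMap.rTensor B s (Coalgebra.comul c))

/-- The grading induced on the quotient bialgebra `B = T(V)/⟨R⟩`. -/
def quotGrade (π : TensorAlgebra k V →ₐ[k] B) : ℕ → Submodule k B :=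
  fun n => Submodule.map π.toLinearMap (tgrade k V n)

section TensorAlgebraLemmas

variable {k V : Type*} [Field k] [AddCommGroup V] [Module k V]

instance : GradedAlgebra (tgrade k V) :=
  inferInstanceAs (GradedAlgebra fun n : ℕ =>
    LinearMap.range (TensorAlgebra.ι k : V →ₗ[k] TensorAlgebra k V) ^ n)

theorem comulT_one : comulT k V 1 = 1 ⊗ₜ 1 := by
  simp [comulT, Algebra.TensorProduct.one_def]

theorem comulT_mul (a b : TensorAlgebra k V) :
    comulT k V (a * b) = comulT k V a * comulT k V b := by
  simp [comulT]

theorem comulT_ι (v : V) :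
    comulT k V (TensorAlgebra.ι k v)
      = TensorAlgebra.ι k v ⊗ₜ 1 + 1 ⊗ₜ TensorAlgebra.ι k v := by
  simp [comulT, diagV]

theorem ι_mem_tgrade_one (v : V) : TensorAlgebra.ι k v ∈ tgrade k V 1 := by
  simp [tgrade]

theorem ι_mul_mem_tgrade (v : V) {n : ℕ} {t : TensorAlgebra k V} (ht : t ∈ tgrade k V n) :
    TensorAlgebra.ι k v * t ∈ tgrade k V (n + 1) := by
  rw [add_comm]
  exact SetLike.mul_mem_graded (ι_mem_tgrade_one v) ht

/-- Induction on homogeneous elements of the tensor algebra by left multiplication by vectors. -/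
theorem tgrade_induction {C : ∀ (n : ℕ) (x : TensorAlgebra k V), x ∈ tgrade k V n → Prop}
    (one : C 0 1 SetLike.GradedOne.one_mem)
    (smul : ∀ n (c : k) x hx, C n x hx → C n (c • x) (Submodule.smul_mem _ c hx))
    (add : ∀ n x y hx hy, C n x hx → C n y hy → C n (x + y) (Submodule.add_mem _ hx hy))
    (ι_mul : ∀ (v : V) n x hx, C n x hx →
      C (n + 1) (TensorAlgebra.ι k v * x) (ι_mul_mem_tgrade v hx))
    {n : ℕ} {x : TensorAlgebra k V} (hx : x ∈ tgrade k V n) : C n x hx := by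
  refine Submodule.pow_induction_on_left'
    (LinearMap.range (TensorAlgebra.ι k : V →ₗ[k] TensorAlgebra k V))
    (C := C) (fun r => ?_) (fun x y i => add i x y) ?_ hx
  · simp only [Algebra.algebraMap_eq_smul_one]
    exact smul _ _ _ _ one
  · rintro _ ⟨v, rfl⟩ i x hx h
    exact ι_mul v i x hx h

/-- The projection of the tensor algebra onto the sum of a set of its homogeneous components. -/
theorem exists_proj (p : ℕ → Prop) : ∃ P : TensorAlgebra k V →ₗ[k] TensorAlgebra k V,
    ∀ i, ∀ x ∈ tgrade k V i, (p i → P x = x) ∧ (¬ p i → P x = 0) := by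
  classical
  refine ⟨DirectSum.toModule k ℕ (TensorAlgebra k V)
    (fun i => if p i then (tgrade k V i).subtype else 0) ∘ₗ
      (DirectSum.decomposeLinearEquiv (tgrade k V)).toLinearMap, fun i x hx => ?_⟩
  simp only [LinearMap.comp_apply, LinearEquiv.coe_coe, DirectSum.decomposeLinearEquiv_apply,
    DirectSum.decompose_of_mem _ hx]
  erw [DirectSum.toModule_lof]
  constructor <;> intro h <;> simp [h]

variable {B : Type*} [Ring B] [Algebra k B]

/-- If `u` vanishes below degree `n`, only the extreme right component of `Δ(t)` survives `p ⊗ u`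
for `t` of degree `n`. -/
theorem map_comulT_right (p : TensorAlgebra k V →ₐ[k] B) {n : ℕ} {t : TensorAlgebra k V}
    (ht : t ∈ tgrade k V n) :
    ∀ u : TensorAlgebra k V →ₗ[k] B, (∀ i < n, ∀ x ∈ tgrade k V i, u x = 0) →
      TensorProduct.map p.toLinearMap u (comulT k V t) = 1 ⊗ₜ u t := by
  induction ht using tgrade_induction with
  | one => intro u _; simp [comulT_one]
  | smul n c x _ ih => intro u hu; simp [ih u hu]
  | add n x y _ _ ihx ihy => intro u hu; simp [ihx u hu, ihy u hu, tmul_add]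
  | ι_mul v n x hx ih =>
    intro u hu
    have hleft : ∀ X : TensorAlgebra k V ⊗[k] TensorAlgebra k V,
        TensorProduct.map p.toLinearMap u ((TensorAlgebra.ι k v ⊗ₜ 1) * X)
          = (p (TensorAlgebra.ι k v) ⊗ₜ 1) * TensorProduct.map p.toLinearMap u X := by
      intro X
      induction X with
      | zero => simp
      | tmul a b => simp
      | add X Y hX hY => simp only [mul_add, map_add, hX, hY]
    have hright : ∀ X : TensorAlgebra k V ⊗[k] TensorAlgebra k V,
        TensorProduct.map p.toLinearMap u ((1 ⊗ₜ TensorAlgebra.ι k v) * X)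
          = TensorProduct.map p.toLinearMap
            (u ∘ₗ LinearMap.mulLeft k (TensorAlgebra.ι k v)) X := by
      intro X
      induction X with
      | zero => simp
      | tmul a b => simp
      | add X Y hX hY => simp only [mul_add, map_add, hX, hY]
    rw [comulT_mul, comulT_ι, add_mul, map_add, hleft, hright,
      ih u (fun i hi => hu i (by omega)),
      ih _ (fun i hi y hy => hu (i + 1) (by omega) (_ * y) (ι_mul_mem_tgrade v hy)),
      hu n (by omega) x hx]
    simp

/-- If `u` vanishes below degree `n`, only the extreme left component of `Δ(t)` survives `u ⊗ p`
for `t` of degree `n`. -/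
theorem map_comulT_left (p : TensorAlgebra k V →ₐ[k] B) {n : ℕ} {t : TensorAlgebra k V}
    (ht : t ∈ tgrade k V n) :
    ∀ u : TensorAlgebra k V →ₗ[k] B, (∀ i < n, ∀ x ∈ tgrade k V i, u x = 0) →
      TensorProduct.map u p.toLinearMap (comulT k V t) = u t ⊗ₜ 1 := by
  induction ht using tgrade_induction with
  | one => intro u _; simp [comulT_one]
  | smul n c x _ ih => intro u hu; simp [ih u hu, smul_tmul']
  | add n x y _ _ ihx ihy => intro u hu; simp [ihx u hu, ihy u hu, add_tmul]
  | ι_mul v n x hx ih =>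
    intro u hu
    have hright : ∀ X : TensorAlgebra k V ⊗[k] TensorAlgebra k V,
        TensorProduct.map u p.toLinearMap ((1 ⊗ₜ TensorAlgebra.ι k v) * X)
          = (1 ⊗ₜ p (TensorAlgebra.ι k v)) * TensorProduct.map u p.toLinearMap X := by
      intro X
      induction X with
      | zero => simp
      | tmul a b => simp
      | add X Y hX hY => simp only [mul_add, map_add, hX, hY]
    have hleft : ∀ X : TensorAlgebra k V ⊗[k] TensorAlgebra k V,
        TensorProduct.map u p.toLinearMap ((TensorAlgebra.ι k v ⊗ₜ 1) * X)
          = TensorProduct.map (u ∘ₗ LinearMap.mulLeft k (TensorAlgebra.ι k v))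
            p.toLinearMap X := by
      intro X
      induction X with
      | zero => simp
      | tmul a b => simp
      | add X Y hX hY => simp only [mul_add, map_add, hX, hY]
    rw [comulT_mul, comulT_ι, add_mul, map_add, hleft, hright,
      ih u (fun i hi => hu i (by omega)),
      ih _ (fun i hi y hy => hu (i + 1) (by omega) (_ * y) (ι_mul_mem_tgrade v hy)),
      hu n (by omega) x hx]
    simp

/-- A Hochschild 2-cocycle pulled back to the tensor algebra is a coboundary. -/
theorem exists_hochschild_primitive (p : TensorAlgebra k V →ₐ[k] B) (f : B ⊗[k] B →ₗ[k] B)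
    (hf_one_left : ∀ a, f (1 ⊗ₜ a) = 0) (hf_one_right : ∀ a, f (a ⊗ₜ 1) = 0)
    (hf : ∀ a b c : B, a * f (b ⊗ₜ c) + f (a ⊗ₜ (b * c)) = f ((a * b) ⊗ₜ c) + f (a ⊗ₜ b) * c) :
    ∃ s : TensorAlgebra k V →ₗ[k] B, s 1 = 0 ∧ (∀ v, s (TensorAlgebra.ι k v) = 0) ∧
      ∀ a b, s (a * b) = p a * s b + s a * p b - f (p a ⊗ₜ p b) := by
  let act : B →ₗ[k] Module.End k (B × B) := LinearMap.mk₂ k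
    (fun x y => (x * y.1, x * y.2 - f (x ⊗ₜ y.1)))
    (fun x x' y => by ext <;> simp [add_mul, add_tmul]; abel)
    (fun c x y => by ext <;> simp [← smul_tmul', smul_sub])
    (fun x y y' => by ext <;> simp [mul_add, tmul_add]; abel)
    (fun c x y => by ext <;> simp [smul_sub])
  have hact : ∀ x y, act x y = (x * y.1, x * y.2 - f (x ⊗ₜ y.1)) := fun _ _ => rfl
  let φ : TensorAlgebra k V →ₐ[k] Module.End k (B × B) :=
    TensorAlgebra.lift k (act ∘ₗ p.toLinearMap ∘ₗ TensorAlgebra.ι k)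
  have hφι : ∀ v, φ (TensorAlgebra.ι k v) = act (p (TensorAlgebra.ι k v)) := fun v => by simp [φ]
  have hφfst : ∀ t y, (φ t y).1 = p t * y.1 := by
    intro t
    induction t using TensorAlgebra.induction with
    | algebraMap r => intro y; simp [Algebra.smul_def]
    | ι v => intro y; rw [hφι, hact]
    | mul a b ha hb => intro y; simp [ha, hb, mul_assoc]
    | add a b ha hb => intro y; simp [ha, hb, add_mul]
  let s : TensorAlgebra k V →ₗ[k] B :=
    LinearMap.snd k B B ∘ₗ LinearMap.applyₗ ((1, 0) : B × B) ∘ₗ φ.toLinearMap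
  have hs : ∀ t, s t = (φ t (1, 0)).2 := fun _ => rfl
  have hs_one : s 1 = 0 := by simp [hs]
  have hs_ι : ∀ v, s (TensorAlgebra.ι k v) = 0 := fun v => by
    simp [hs, hφι, hact, hf_one_right]
  refine ⟨s, hs_one, hs_ι, fun a => ?_⟩
  induction a using TensorAlgebra.induction with
  | algebraMap r =>
    intro b
    simp [Algebra.algebraMap_eq_smul_one, ← smul_tmul', hf_one_left, hs_one]
  | ι v =>
    intro b
    simp only [hs_ι, zero_mul, add_zero]
    simp [hs, hφι, hact, hφfst]
  | mul a b ha hb =>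
    intro c
    have h := hf (p a) (p b) (p c)
    rw [mul_assoc, ha, hb, ha]
    simp only [map_mul]
    rw [eq_sub_iff_add_eq.2 h.symm]
    noncomm_ring
  | add a b ha hb =>
    intro c
    simp only [add_mul, map_add, ha, hb, add_tmul]
    abel

end TensorAlgebraLemmas

section BialgebraLemmas

variable {k B : Type*} [Field k] [Ring B] [Bialgebra k B]

theorem sub_counit_mem_Bplus (a : B) :
    a - algebraMap k B (Coalgebra.counit (R := k) a) ∈ Bplus k B := by
  simp [Bplus]

/-- A linear condition on a bialgebra holds as soon as it holds at `1` and on the augmentation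
ideal. -/
theorem induction_Bplus {C : B → Prop} (one : C 1) (smul : ∀ (c : k) x, C x → C (c • x))
    (add : ∀ x y, C x → C y → C (x + y)) (plus : ∀ x ∈ Bplus k B, C x) (x : B) : C x := by
  rw [← sub_add_cancel x (algebraMap k B (Coalgebra.counit (R := k) x))]
  refine add _ _ (plus _ (sub_counit_mem_Bplus x)) ?_
  rw [Algebra.algebraMap_eq_smul_one]
  exact smul _ _ one

theorem hochschild_of_Bplus {f : B ⊗[k] B →ₗ[k] B}
    (hf_one_left : ∀ a, f (1 ⊗ₜ a) = 0) (hf_one_right : ∀ a, f (a ⊗ₜ 1) = 0)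
    (hf : ∀ a b c : B, a ∈ Bplus k B → b ∈ Bplus k B → c ∈ Bplus k B →
      a * f (b ⊗ₜ[k] c) + f (a ⊗ₜ[k] (b * c)) = f ((a * b) ⊗ₜ[k] c) + f (a ⊗ₜ[k] b) * c)
    (a b c : B) :
    a * f (b ⊗ₜ c) + f (a ⊗ₜ (b * c)) = f ((a * b) ⊗ₜ c) + f (a ⊗ₜ b) * c := by
  induction a using induction_Bplus (k := k) (B := B) with
  | one => simp [hf_one_left]
  | smul r x h => simp only [smul_mul_assoc, ← smul_tmul', map_smul, ← smul_add, h]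
  | add x y hx hy =>
    simp only [add_mul, add_tmul, map_add]
    linear_combination (norm := abel) hx + hy
  | plus a ha =>
    induction b using induction_Bplus (k := k) (B := B) with
    | one => simp [hf_one_left, hf_one_right]
    | smul r x h =>
      simp only [smul_mul_assoc, mul_smul_comm, ← smul_tmul', tmul_smul, map_smul, ← smul_add, h]
    | add x y hx hy =>
      simp only [add_mul, mul_add, add_tmul, tmul_add, map_add]
      linear_combination (norm := abel) hx + hy
    | plus b hb =>
      induction c using induction_Bplus (k := k) (B := B) with
      | one => simp [hf_one_right]
      | smul r x h => simp only [mul_smul_comm, tmul_smul, map_smul, ← smul_add, h]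
      | add x y hx hy =>
        simp only [mul_add, tmul_add, map_add]
        linear_combination (norm := abel) hx + hy
      | plus c hc => exact hf a b c ha hb hc

theorem comul2_one_left (b : B) :
    comul2 k B (1 ⊗ₜ b) = TensorProduct.map (TensorProduct.mk k B B 1)
      (TensorProduct.mk k B B 1) (Coalgebra.comul b) := by
  simp only [comul2, LinearMap.comp_apply, map_tmul, Bialgebra.comul_one,
    Algebra.TensorProduct.one_def]
  induction Coalgebra.comul (R := k) b with
  | zero => simp
  | tmul x y => simp
  | add x y hx hy => simp only [tmul_add, map_add, hx, hy]

theorem comul2_one_right (a : B) :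
    comul2 k B (a ⊗ₜ 1) = TensorProduct.map ((TensorProduct.mk k B B).flip 1)
      ((TensorProduct.mk k B B).flip 1) (Coalgebra.comul a) := by
  simp only [comul2, LinearMap.comp_apply, map_tmul, Bialgebra.comul_one,
    Algebra.TensorProduct.one_def]
  induction Coalgebra.comul (R := k) a with
  | zero => simp
  | tmul x y => simp
  | add x y hx hy => simp only [add_tmul, map_add, hx, hy]

theorem compatibility_of_Bplus {f : B ⊗[k] B →ₗ[k] B} {g : B →ₗ[k] B ⊗[k] B}
    (hf_one_left : ∀ a, f (1 ⊗ₜ a) = 0) (hf_one_right : ∀ a, f (a ⊗ₜ 1) = 0) (hg_one : g 1 = 0)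
    (hfg : ∀ a b : B, a ∈ Bplus k B → b ∈ Bplus k B →
      TensorProduct.map f (LinearMap.mul' k B) (comul2 k B (a ⊗ₜ[k] b))
        + TensorProduct.map (LinearMap.mul' k B) f (comul2 k B (a ⊗ₜ[k] b))
        - Coalgebra.comul (f (a ⊗ₜ[k] b))
        = -(Coalgebra.comul (R := k) a * g b) + g (a * b) - g a * Coalgebra.comul (R := k) b)
    (a b : B) :
    TensorProduct.map f (LinearMap.mul' k B) (comul2 k B (a ⊗ₜ[k] b))
      + TensorProduct.map (LinearMap.mul' k B) f (comul2 k B (a ⊗ₜ[k] b))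
      - Coalgebra.comul (f (a ⊗ₜ[k] b))
      = -(Coalgebra.comul (R := k) a * g b) + g (a * b) - g a * Coalgebra.comul (R := k) b := by
  have hmk_left : f ∘ₗ TensorProduct.mk k B B 1 = 0 := LinearMap.ext hf_one_left
  have hmk_right : f ∘ₗ (TensorProduct.mk k B B).flip 1 = 0 := LinearMap.ext hf_one_right
  induction a using induction_Bplus (k := k) (B := B) with
  | one =>
    rw [comul2_one_left, map_map, map_map, hmk_left]
    simp [hf_one_left, hg_one]
  | smul r x h =>
    simp only [smul_mul_assoc, ← smul_tmul', map_smul, ← smul_add, ← smul_sub, ← smul_neg, h]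
  | add x y hx hy =>
    simp only [add_mul, add_tmul, map_add]
    linear_combination (norm := abel) hx + hy
  | plus a ha =>
    induction b using induction_Bplus (k := k) (B := B) with
    | one =>
      rw [comul2_one_right, map_map, map_map, hmk_right]
      simp [hf_one_right, hg_one]
    | smul r x h =>
      simp only [mul_smul_comm, tmul_smul, map_smul, ← smul_add, ← smul_sub, ← smul_neg, h]
    | add x y hx hy =>
      simp only [mul_add, tmul_add, map_add]
      linear_combination (norm := abel) hx + hy
    | plus b hb => exact hfg a b ha hb

end BialgebraLemmas

section QuotientLemmas

variable {k V B : Type*} [Field k] [AddCommGroup V] [Module k V] [Ring B] [Bialgebra k B]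
  {π : TensorAlgebra k V →ₐ[k] B} {f : B ⊗[k] B →ₗ[k] B} {s : TensorAlgebra k V →ₗ[k] B}

theorem map_mul_right_of_hochschild
    (hs : ∀ a b, s (a * b) = π a * s b + s a * π b - f (π a ⊗ₜ π b))
    (X Y : TensorAlgebra k V ⊗[k] TensorAlgebra k V) :
    TensorProduct.map π.toLinearMap s (X * Y)
      = TensorProduct.map π.toLinearMap π.toLinearMap X * TensorProduct.map π.toLinearMap s Y
        + TensorProduct.map π.toLinearMap s X * TensorProduct.map π.toLinearMap π.toLinearMap Y
        - TensorProduct.map (LinearMap.mul' k B) f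
          (TensorProduct.tensorTensorTensorComm k B B B B
            (TensorProduct.map π.toLinearMap π.toLinearMap X ⊗ₜ
              TensorProduct.map π.toLinearMap π.toLinearMap Y)) := by
  induction X with
  | zero => simp
  | add X X' hX hX' => simp only [add_mul, map_add, hX, hX', add_tmul]; abel
  | tmul a b =>
    induction Y with
    | zero => simp
    | add Y Y' hY hY' => simp only [mul_add, map_add, hY, hY', tmul_add]; abel
    | tmul c d => simp [hs, tmul_add, tmul_sub]

theorem map_mul_left_of_hochschild
    (hs : ∀ a b, s (a * b) = π a * s b + s a * π b - f (π a ⊗ₜ π b))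
    (X Y : TensorAlgebra k V ⊗[k] TensorAlgebra k V) :
    TensorProduct.map s π.toLinearMap (X * Y)
      = TensorProduct.map π.toLinearMap π.toLinearMap X * TensorProduct.map s π.toLinearMap Y
        + TensorProduct.map s π.toLinearMap X * TensorProduct.map π.toLinearMap π.toLinearMap Y
        - TensorProduct.map f (LinearMap.mul' k B)
          (TensorProduct.tensorTensorTensorComm k B B B B
            (TensorProduct.map π.toLinearMap π.toLinearMap X ⊗ₜ
              TensorProduct.map π.toLinearMap π.toLinearMap Y)) := by
  induction X with
  | zero => simp
  | add X X' hX hX' => simp only [add_mul, map_add, hX, hX', add_tmul]; abel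
  | tmul a b =>
    induction Y with
    | zero => simp
    | add Y Y' hY hY' => simp only [mul_add, map_add, hY, hY', tmul_add]; abel
    | tmul c d => simp [hs, add_tmul, sub_tmul]

theorem gradeZ_natCast {ℬ : ℕ → Submodule k B} (n : ℕ) : gradeZ k B ℬ n = ℬ n := by
  simp [gradeZ]

theorem ι_mul_mem_gradeZ (v : V) {z : ℤ} {x : B} (hx : x ∈ gradeZ k B (quotGrade k V B π) z) :
    π (TensorAlgebra.ι k v) * x ∈ gradeZ k B (quotGrade k V B π) (z + 1) := by
  by_cases hz : 0 ≤ z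
  · lift z to ℕ using hz
    rw [gradeZ_natCast] at hx
    obtain ⟨t, ht, rfl⟩ := hx
    rw [← Nat.cast_succ, gradeZ_natCast]
    exact ⟨_, ι_mul_mem_tgrade v ht, by simp⟩
  · rw [gradeZ, if_neg hz, Submodule.mem_bot] at hx
    simp [hx]

theorem tmul_mem_tensorGrade {ℬ : ℕ → Submodule k B} {i j : ℕ} {x y : B} (hx : x ∈ ℬ i)
    (hy : y ∈ ℬ j) : x ⊗ₜ y ∈ tensorGrade k B ℬ (i + j) := by
  refine Submodule.mem_iSup_of_mem (i, j) (Submodule.mem_iSup_of_mem rfl ?_)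
  exact ⟨(⟨x, hx⟩ : ℬ i) ⊗ₜ (⟨y, hy⟩ : ℬ j), by simp⟩

theorem hochschild_primitive_mem_gradeZ {ℓ : ℤ} (hf : HomogF k B (quotGrade k V B π) ℓ f)
    (hs_one : s 1 = 0) (hs_ι : ∀ v, s (TensorAlgebra.ι k v) = 0)
    (hs : ∀ a b, s (a * b) = π a * s b + s a * π b - f (π a ⊗ₜ π b)) {n : ℕ}
    {t : TensorAlgebra k V} (ht : t ∈ tgrade k V n) :
    s t ∈ gradeZ k B (quotGrade k V B π) (n + ℓ) := by
  induction ht using tgrade_induction with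
  | one => simp [hs_one]
  | smul n c x _ h => simpa using Submodule.smul_mem _ c h
  | add n x y _ _ hx hy => simpa using Submodule.add_mem _ hx hy
  | ι_mul v n x hx h =>
    rw [hs, hs_ι, zero_mul, add_zero]
    refine Submodule.sub_mem _ ?_ ?_
    · convert ι_mul_mem_gradeZ v h using 2
      push_cast; ring
    · refine hf _ _ ?_
      rw [add_comm]
      exact tmul_mem_tensorGrade (Submodule.mem_map_of_mem (ι_mem_tgrade_one v))
        (Submodule.mem_map_of_mem hx)

theorem hochschild_primitive_mem_Bplus (hf : ∀ u, f u ∈ Bplus k B)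
    (hs_one : s 1 = 0) (hs_ι : ∀ v, s (TensorAlgebra.ι k v) = 0)
    (hs : ∀ a b, s (a * b) = π a * s b + s a * π b - f (π a ⊗ₜ π b)) (t : TensorAlgebra k V) :
    s t ∈ Bplus k B := by
  simp only [Bplus, LinearMap.mem_ker] at hf ⊢
  induction t using TensorAlgebra.induction with
  | algebraMap r => simp [Algebra.algebraMap_eq_smul_one, hs_one]
  | ι v => simp [hs_ι]
  | mul a b ha hb => simp [hs, ha, hb, hf]
  | add a b ha hb => simp [ha, hb]

/-- `B⁺ ⊗ B⁺` has no nonzero elements of degree at most `0`. -/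
theorem eq_zero_of_mem_tensorGradeZ {z : ℤ} (hz : z ≤ 0) {u : B ⊗[k] B}
    (hu : u ∈ tensorGradeZ k B (quotGrade k V B π) z) (hu' : u ∈ BpBp k B) : u = 0 := by
  obtain hz | rfl := hz.lt_or_eq
  · rwa [tensorGradeZ, if_neg (by omega), Submodule.mem_bot] at hu
  let ε₂ : B ⊗[k] B →ₗ[k] k :=
    LinearMap.mul' k k ∘ₗ TensorProduct.map Coalgebra.counit Coalgebra.counit
  have hε₂ : ε₂ u = 0 := by
    clear hu
    obtain ⟨w, rfl⟩ := hu'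
    induction w with
    | zero => simp
    | add x y hx hy => simp only [map_add, hx, hy, add_zero]
    | tmul x y =>
      have hx : Coalgebra.counit (R := k) (x : B) = 0 := x.2
      simp [ε₂, hx]
  have hscalar : u ∈ k ∙ ((1 : B) ⊗ₜ[k] (1 : B)) := by
    rw [tensorGradeZ, if_pos le_rfl] at hu
    refine (iSup₂_le ?_ : tensorGrade k B (quotGrade k V B π) 0 ≤ _) hu
    rintro ⟨i, j⟩ hij
    obtain ⟨rfl, rfl⟩ : i = 0 ∧ j = 0 := by simpa using hij
    have hzero : ∀ x ∈ quotGrade k V B π 0, ∃ c : k, x = c • 1 := by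
      rintro _ ⟨t, ht, rfl⟩
      obtain ⟨c, rfl⟩ : ∃ c : k, algebraMap k _ c = t := by
        simpa [tgrade, Submodule.mem_one] using ht
      exact ⟨c, by simp [Algebra.algebraMap_eq_smul_one]⟩
    rintro _ ⟨w, rfl⟩
    induction w with
    | zero => simp
    | add x y hx hy => simpa only [map_add] using Submodule.add_mem _ hx hy
    | tmul x y =>
      obtain ⟨c, hc⟩ := hzero x x.2
      obtain ⟨d, hd⟩ := hzero y y.2
      refine Submodule.mem_span_singleton.2 ⟨d * c, ?_⟩
      simp [hc, hd, ← smul_tmul', smul_smul]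
  obtain ⟨c, rfl⟩ := Submodule.mem_span_singleton.1 hscalar
  have hc : c = 0 := by simpa [ε₂] using hε₂
  simp [hc]

/-- The truncated cocycle pulled back to the tensor algebra is the coboundary of a Hochschild
primitive of its first component. -/
theorem comp_eq_coboundary
    (hπcomul : (Coalgebra.comul (R := k) (A := B)) ∘ₗ π.toLinearMap
      = TensorProduct.map π.toLinearMap π.toLinearMap ∘ₗ comulT k V)
    {ℓ : ℤ} (hℓ : ℓ < 0) {g : B →ₗ[k] B ⊗[k] B} (hg_one : g 1 = 0)
    (hg_mem : ∀ x : B, g x ∈ BpBp k B) (hg : HomogG k B (quotGrade k V B π) ℓ g)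
    (hfg : ∀ a b : B,
      TensorProduct.map f (LinearMap.mul' k B) (comul2 k B (a ⊗ₜ[k] b))
        + TensorProduct.map (LinearMap.mul' k B) f (comul2 k B (a ⊗ₜ[k] b))
        - Coalgebra.comul (f (a ⊗ₜ[k] b))
        = -(Coalgebra.comul (R := k) a * g b) + g (a * b) - g a * Coalgebra.comul (R := k) b)
    (hs_one : s 1 = 0) (hs_ι : ∀ v, s (TensorAlgebra.ι k v) = 0)
    (hs : ∀ a b, s (a * b) = π a * s b + s a * π b - f (π a ⊗ₜ π b)) (t : TensorAlgebra k V) :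
    g (π t) = -(TensorProduct.map π.toLinearMap s (comulT k V t)) + Coalgebra.comul (s t)
      - TensorProduct.map s π.toLinearMap (comulT k V t) := by
  have hΔ : ∀ t, TensorProduct.map π.toLinearMap π.toLinearMap (comulT k V t)
      = Coalgebra.comul (R := k) (π t) := fun t => (LinearMap.congr_fun hπcomul t).symm
  induction t using TensorAlgebra.induction with
  | algebraMap r => simp [Algebra.algebraMap_eq_smul_one, hs_one, hg_one, comulT_one]
  | ι v =>
    have h : g (π (TensorAlgebra.ι k v)) = 0 :=
      eq_zero_of_mem_tensorGradeZ (by push_cast; omega)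
        (hg 1 _ (Submodule.mem_map_of_mem (ι_mem_tgrade_one v))) (hg_mem _)
    rw [h]
    simp [comulT_ι, hs_ι, hs_one]
  | add a b ha hb => simp only [map_add, ha, hb]; abel
  | mul a b ha hb =>
    have h := hfg (π a) (π b)
    rw [ha, hb, ← map_mul] at h
    rw [comulT_mul, map_mul_left_of_hochschild hs, map_mul_right_of_hochschild hs, hs, hΔ, hΔ]
    simp only [map_add, map_sub, Bialgebra.comul_mul]
    simp only [comul2, LinearMap.comp_apply, map_tmul, LinearEquiv.coe_coe] at h
    have h' := sub_eq_zero.2 h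
    rw [← sub_eq_zero, ← neg_eq_zero, ← h']
    noncomm_ring

theorem exists_factor (hπ : Function.Surjective π) {u : TensorAlgebra k V →ₗ[k] B}
    (hu : ∀ x, π x = 0 → u x = 0) : ∃ w : B →ₗ[k] B, w ∘ₗ π.toLinearMap = u := by
  obtain ⟨σ, hσ⟩ := π.toLinearMap.exists_rightInverse_of_surjective (LinearMap.range_eq_top.2 hπ)
  refine ⟨u ∘ₗ σ, LinearMap.ext fun x => ?_⟩
  have h := hu (σ (π x) - x) (by
    have := LinearMap.congr_fun hσ (π x)
    simpa [sub_eq_zero] using this)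
  simpa [sub_eq_zero] using h

variable {R : Submodule k (TensorAlgebra k V)}

/-- On a relation whose lower-degree companions are killed by `s`, the mixed terms of the
coboundary of `s` reduce to the primitive ones. -/
theorem map_comulT_of_mem_relations
    (hRgraded : R = ⨆ n : ℕ, R ⊓ tgrade k V n) (hπsurj : Function.Surjective π)
    (hπker : LinearMap.ker π.toLinearMap = Submodule.span k
      {x | ∃ (a r b : TensorAlgebra k V), r ∈ R ∧ x = a * r * b})
    (hπcomul : (Coalgebra.comul (R := k) (A := B)) ∘ₗ π.toLinearMap
      = TensorProduct.map π.toLinearMap π.toLinearMap ∘ₗ comulT k V)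
    (hs : ∀ a r b, r ∈ R → s (a * r * b) = π a * s r * π b) {n : ℕ}
    (ih : ∀ m < n, ∀ r ∈ R, r ∈ tgrade k V m → s r = 0) {r : TensorAlgebra k V} (hr : r ∈ R)
    (hrn : r ∈ tgrade k V n) :
    TensorProduct.map π.toLinearMap s (comulT k V r) = 1 ⊗ₜ s r ∧
      TensorProduct.map s π.toLinearMap (comulT k V r) = s r ⊗ₜ 1 := by
  obtain ⟨P, hP⟩ := exists_proj (k := k) (V := V) (· < n)
  have hkill : ∀ x, π x = 0 → (s ∘ₗ P) x = 0 := by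
    intro x hx
    have hx' : x ∈ LinearMap.ker π.toLinearMap := hx
    rw [hπker] at hx'
    refine (Submodule.span_le (p := LinearMap.ker (s ∘ₗ P))).2 ?_ hx'
    rintro _ ⟨a, r, b, hr, rfl⟩
    change s (P (a * r * b)) = 0
    rw [hRgraded] at hr
    induction hr using Submodule.iSup_induction' with
    | zero => simp
    | add x y _ _ hx hy => simp only [mul_add, add_mul, map_add, hx, hy, add_zero]
    | mem j r hr =>
      induction a using DirectSum.Decomposition.inductionOn (tgrade k V) with
      | zero => simp
      | add x y hx hy => simp only [add_mul, map_add, hx, hy, add_zero]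
      | @homogeneous i a =>
        induction b using DirectSum.Decomposition.inductionOn (tgrade k V) with
        | zero => simp
        | add x y hx hy => simp only [mul_add, map_add, hx, hy, add_zero]
        | @homogeneous l b =>
          have hmem : (a : TensorAlgebra k V) * r * b ∈ tgrade k V (i + j + l) :=
            SetLike.mul_mem_graded (SetLike.mul_mem_graded a.2 hr.2) b.2
          by_cases h : i + j + l < n
          · rw [(hP _ _ hmem).1 h, hs _ _ _ hr.1, ih j (by omega) r hr.1 hr.2]
            simp
          · rw [(hP _ _ hmem).2 h, map_zero]
  have hπr : π r = 0 := by
    have : r ∈ LinearMap.ker π.toLinearMap := by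
      rw [hπker]
      exact Submodule.subset_span ⟨1, r, 1, hr, by simp⟩
    exact this
  obtain ⟨w, hw⟩ := exists_factor hπsurj hkill
  have hΔr : TensorProduct.map π.toLinearMap π.toLinearMap (comulT k V r) = 0 := by
    rw [← LinearMap.comp_apply, ← hπcomul]
    simp [hπr]
  have hlow_right : TensorProduct.map π.toLinearMap (s ∘ₗ P) (comulT k V r) = 0 := by
    rw [← hw, show TensorProduct.map π.toLinearMap (w ∘ₗ π.toLinearMap)
      = TensorProduct.map LinearMap.id w ∘ₗ TensorProduct.map π.toLinearMap π.toLinearMap by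
        rw [← map_comp, LinearMap.id_comp], LinearMap.comp_apply, hΔr, map_zero]
  have hlow_left : TensorProduct.map (s ∘ₗ P) π.toLinearMap (comulT k V r) = 0 := by
    rw [← hw, show TensorProduct.map (w ∘ₗ π.toLinearMap) π.toLinearMap
      = TensorProduct.map w LinearMap.id ∘ₗ TensorProduct.map π.toLinearMap π.toLinearMap by
        rw [← map_comp, LinearMap.id_comp], LinearMap.comp_apply, hΔr, map_zero]
  have hvanish : ∀ i < n, ∀ x ∈ tgrade k V i, (s - s ∘ₗ P) x = 0 := fun i hi x hx => by
    simp [(hP i x hx).1 hi]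
  have hr_eq : (s - s ∘ₗ P) r = s r := by simp [(hP n r hrn).2 (lt_irrefl n)]
  have hright := map_comulT_right π hrn _ hvanish
  have hleft := map_comulT_left π hrn _ hvanish
  constructor
  · rw [← hr_eq, ← hright, ← sub_add_cancel s (s ∘ₗ P), map_add_right, LinearMap.add_apply,
      hlow_right, add_zero, sub_add_cancel]
  · rw [← hr_eq, ← hleft, ← sub_add_cancel s (s ∘ₗ P), map_add_left, LinearMap.add_apply,
      hlow_left, add_zero, sub_add_cancel]

end QuotientLemmas

/-- if `ℓ < 0` and every homogeneous linear map `R → P(B)` of degree `ℓ`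
vanishes, then every truncated bialgebra 2-cocycle of degree `ℓ` on `B = T(V)/⟨R⟩` is a
truncated 2-coboundary. -/
theorem stmt_9 (k V : Type*) [Field k] [CharZero k] [AddCommGroup V] [Module k V]
    (B : Type*) [Ring B] [Bialgebra k B]
    -- `R` is a graded subspace of `T(V)_{(2)}`:
    (R : Submodule k (TensorAlgebra k V)) (hR : R ≤ Ttwo k V)
    (hRgraded : R = ⨆ n : ℕ, R ⊓ tgrade k V n)
    -- `B = T(V)/⟨R⟩` as a bialgebra, with canonical projection `π` (in particular the
    -- two-sided ideal `⟨R⟩` is a coideal of `T(V)`):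
    (π : TensorAlgebra k V →ₐ[k] B)
    (hπsurj : Function.Surjective π)
    (hπker : LinearMap.ker π.toLinearMap = Submodule.span k
      {x | ∃ (a r b : TensorAlgebra k V), r ∈ R ∧ x = a * r * b})
    (hπcomul : (Coalgebra.comul (R := k) (A := B)) ∘ₗ π.toLinearMap
      = TensorProduct.map π.toLinearMap π.toLinearMap ∘ₗ comulT k V)
    (hπcounit : (Coalgebra.counit (R := k) (A := B)) ∘ₗ π.toLinearMap = counitT k V)
    (ℓ : ℤ) (hℓ : ℓ < 0)
    -- every homogeneous linear map `R → P(B)` of degree `ℓ` is zero: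
    (hhom : ∀ h : ↥R →ₗ[k] B,
      (∀ x : ↥R, Coalgebra.comul (R := k) (h x) = h x ⊗ₜ[k] 1 + 1 ⊗ₜ[k] h x) →
      (∀ (n : ℕ) (x : ↥R), (x : TensorAlgebra k V) ∈ tgrade k V n →
        h x ∈ gradeZ k B (quotGrade k V B π) ((n : ℤ) + ℓ)) →
      h = 0)
    (f : B ⊗[k] B →ₗ[k] B) (g : B →ₗ[k] B ⊗[k] B)
    (hfg : IsTruncCocycle k B (quotGrade k V B π) ℓ f g) :
    IsTruncCoboundary k B (quotGrade k V B π) ℓ f g := by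
  obtain ⟨hf_one_left, hf_one_right, hf_mem, hg_one, hg_mem, hf_deg, hg_deg, hf, -, hcompat⟩ := hfg
  obtain ⟨s, hs_one, hs_ι, hs⟩ := exists_hochschild_primitive π f hf_one_left hf_one_right
    (hochschild_of_Bplus hf_one_left hf_one_right hf)
  have hgs := comp_eq_coboundary hπcomul hℓ hg_one hg_mem hg_deg
    (compatibility_of_Bplus hf_one_left hf_one_right hg_one hcompat) hs_one hs_ι hs
  have hs_deg : ∀ (n : ℕ) (t : TensorAlgebra k V), t ∈ tgrade k V n →
      s t ∈ gradeZ k B (quotGrade k V B π) (n + ℓ) := fun n t ht =>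
    hochschild_primitive_mem_gradeZ hf_deg hs_one hs_ι hs ht
  have hπR : ∀ r ∈ R, π r = 0 := fun r hr => by
    have : r ∈ LinearMap.ker π.toLinearMap := by
      rw [hπker]
      exact Submodule.subset_span ⟨1, r, 1, hr, by simp⟩
    exact this
  have hs_ideal : ∀ a r b, r ∈ R → s (a * r * b) = π a * s r * π b := fun a r b hr => by
    rw [hs, hs, map_mul, hπR r hr]
    simp
  have hsR_deg : ∀ n, ∀ r ∈ R, r ∈ tgrade k V n → s r = 0 := by
    intro n
    induction n using Nat.strong_induction_on with
    | _ n ih =>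
    have hprim : ∀ r ∈ R, r ∈ tgrade k V n →
        Coalgebra.comul (R := k) (s r) = s r ⊗ₜ[k] 1 + 1 ⊗ₜ[k] s r := by
      intro r hr hrn
      obtain ⟨hright, hleft⟩ := map_comulT_of_mem_relations hRgraded hπsurj hπker hπcomul
        hs_ideal ih hr hrn
      have h := hgs r
      rw [hπR r hr, map_zero, hright, hleft, eq_comm, sub_eq_zero, neg_add_eq_iff_eq_add] at h
      rw [h, add_comm]
    obtain ⟨P, hP⟩ := exists_proj (k := k) (V := V) (· = n)
    have h_zero := hhom (s ∘ₗ P ∘ₗ R.subtype) ?_ ?_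
    · intro r hr hrn
      have := LinearMap.congr_fun h_zero ⟨r, hr⟩
      simpa [(hP n r hrn).1 rfl] using this
    · rintro ⟨r, hr⟩
      change Coalgebra.comul (R := k) (s (P r)) = s (P r) ⊗ₜ[k] 1 + 1 ⊗ₜ[k] s (P r)
      rw [hRgraded] at hr
      induction hr using Submodule.iSup_induction' with
      | zero => simp
      | add x y _ _ hx hy => simp only [map_add, hx, hy, add_tmul, tmul_add]; abel
      | mem j r hr =>
        by_cases h : j = n
        · rw [(hP j r hr.2).1 h, hprim r hr.1 (h ▸ hr.2)]
        · simp [(hP j r hr.2).2 h]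
    · intro m x hx
      change s (P x) ∈ _
      by_cases h : m = n
      · rw [(hP m x hx).1 h]
        exact hs_deg m x hx
      · simp [(hP m x hx).2 h]
  have hsR : ∀ r ∈ R, s r = 0 := by
    intro r hr
    rw [hRgraded] at hr
    induction hr using Submodule.iSup_induction' with
    | zero => simp
    | add x y _ _ hx hy => simp [hx, hy]
    | mem j r hr => exact hsR_deg j r hr.1 hr.2
  obtain ⟨w, hw⟩ := exists_factor (u := s) hπsurj fun x hx => by
    have hx' : x ∈ LinearMap.ker π.toLinearMap := hx
    rw [hπker] at hx'
    refine (Submodule.span_le (p := LinearMap.ker s)).2 ?_ hx'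
    rintro _ ⟨a, r, b, hr, rfl⟩
    simp [hs_ideal a r b hr, hsR r hr]
  have hwπ : ∀ t, w (π t) = s t := LinearMap.congr_fun hw
  have hΔ : ∀ t, Coalgebra.comul (R := k) (π t)
      = TensorProduct.map π.toLinearMap π.toLinearMap (comulT k V t) :=
    LinearMap.congr_fun hπcomul
  refine ⟨w, ?_, ?_, ?_, ?_, ?_⟩
  · rw [← map_one π, hwπ, hs_one]
  · intro x
    obtain ⟨t, rfl⟩ := hπsurj x
    rw [hwπ]
    exact hochschild_primitive_mem_Bplus hf_mem hs_one hs_ι hs t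
  · rintro n _ ⟨t, ht, rfl⟩
    change w (π t) ∈ _
    rw [hwπ]
    exact hs_deg n t ht
  · intro a b _ _
    obtain ⟨a, rfl⟩ := hπsurj a
    obtain ⟨b, rfl⟩ := hπsurj b
    rw [← map_mul, hwπ, hwπ, hwπ, hs]
    abel
  · intro c _
    obtain ⟨t, rfl⟩ := hπsurj c
    rw [hgs t, hwπ, hΔ, LinearMap.lTensor_map, LinearMap.rTensor_map, hw]

end
end Rigidity
end

section
/- Let (L, [·,·], c) be a braided Lie algebra. Then the right-nested Jacobi identity holds: [·,·](id ⊗ [·,·])(id + (c ⊗ id)(id ⊗ c) + (id ⊗ c)(c ⊗ id)) = 0 as a linear map L ⊗ L ⊗ L → L. -/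
/-!
STATEMENT 13: Let (L, [·,·], c) be a braided Lie algebra.  Then the right-nested Jacobi
identity holds: [·,·](id ⊗ [·,·])(id + (c ⊗ id)(id ⊗ c) + (id ⊗ c)(c ⊗ id)) = 0.
-/

open TensorProduct

namespace Rigidity

variable (k L : Type*) [Field k] [AddCommGroup L] [Module k L]

/-- The operator `c ⊗ id` acting on `(L ⊗ L) ⊗ L`. -/
noncomputable def c12 (c : L ⊗[k] L →ₗ[k] L ⊗[k] L) :
    (L ⊗[k] L) ⊗[k] L →ₗ[k] (L ⊗[k] L) ⊗[k] L :=
  LinearMap.rTensor L c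

/-- The operator `id ⊗ c` acting on `(L ⊗ L) ⊗ L` (via the associator). -/
noncomputable def c23 (c : L ⊗[k] L →ₗ[k] L ⊗[k] L) :
    (L ⊗[k] L) ⊗[k] L →ₗ[k] (L ⊗[k] L) ⊗[k] L :=
  (TensorProduct.assoc k L L L).symm.toLinearMap ∘ₗ
    LinearMap.lTensor L c ∘ₗ (TensorProduct.assoc k L L L).toLinearMap

theorem c12_c12_apply (c : L ⊗[k] L →ₗ[k] L ⊗[k] L) (hsym : c ∘ₗ c = LinearMap.id)
    (x : (L ⊗[k] L) ⊗[k] L) : c12 k L c (c12 k L c x) = x := by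
  rw [c12, ← LinearMap.comp_apply, ← LinearMap.rTensor_comp, hsym, LinearMap.rTensor_id,
    LinearMap.id_apply]

theorem c23_c23_apply (c : L ⊗[k] L →ₗ[k] L ⊗[k] L) (hsym : c ∘ₗ c = LinearMap.id)
    (x : (L ⊗[k] L) ⊗[k] L) : c23 k L c (c23 k L c x) = x := by
  simp only [c23, LinearMap.comp_apply, LinearEquiv.coe_coe, LinearEquiv.apply_symm_apply]
  rw [← LinearMap.comp_apply (LinearMap.lTensor L c), ← LinearMap.lTensor_comp, hsym,
    LinearMap.lTensor_id, LinearMap.id_apply, LinearEquiv.symm_apply_apply]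

theorem stmt_13 [CharZero k]
    (c : L ⊗[k] L →ₗ[k] L ⊗[k] L)
    -- `c` is a symmetric braiding (hence in particular a linear isomorphism):
    (hsym : c ∘ₗ c = LinearMap.id)
    (hbraid : c12 k L c ∘ₗ c23 k L c ∘ₗ c12 k L c = c23 k L c ∘ₗ c12 k L c ∘ₗ c23 k L c)
    (br : L ⊗[k] L →ₗ[k] L)
    -- compatibility: `c ([·,·] ⊗ id) = (id ⊗ [·,·])(c ⊗ id)(id ⊗ c)`:
    (hcompat : c ∘ₗ LinearMap.rTensor L br
      = (LinearMap.lTensor L br ∘ₗ (TensorProduct.assoc k L L L).toLinearMap) ∘ₗ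
          c12 k L c ∘ₗ c23 k L c)
    -- anticommutativity:
    (hanti : br ∘ₗ (LinearMap.id + c) = 0)
    -- (left-nested) Jacobi identity:
    (hjacobi : br ∘ₗ LinearMap.rTensor L br ∘ₗ
      (LinearMap.id + c12 k L c ∘ₗ c23 k L c + c23 k L c ∘ₗ c12 k L c) = 0) :
    -- the right-nested Jacobi identity:
    br ∘ₗ (LinearMap.lTensor L br ∘ₗ (TensorProduct.assoc k L L L).toLinearMap) ∘ₗ
      (LinearMap.id + c12 k L c ∘ₗ c23 k L c + c23 k L c ∘ₗ c12 k L c) = 0 := by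
  refine LinearMap.ext fun x => ?_
  have hleft (y : (L ⊗[k] L) ⊗[k] L) : br (LinearMap.rTensor L br y) =
      -br ((LinearMap.lTensor L br ∘ₗ (TensorProduct.assoc k L L L).toLinearMap)
        (c12 k L c (c23 k L c y))) := by
    have h₁ := LinearMap.congr_fun hanti (LinearMap.rTensor L br y)
    have h₂ := LinearMap.congr_fun hcompat y
    simp only [LinearMap.comp_apply, LinearMap.add_apply, LinearMap.id_apply, map_add,
      LinearMap.zero_apply] at h₁ h₂ ⊢
    rw [← h₂]
    exact eq_neg_of_add_eq_zero_left h₁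
  have hcube : c12 k L c (c23 k L c (c12 k L c (c23 k L c x))) = c23 k L c (c12 k L c x) := by
    have h := LinearMap.congr_fun hbraid (c23 k L c x)
    simpa only [LinearMap.comp_apply, c23_c23_apply k L c hsym] using h
  have hj := LinearMap.congr_fun hjacobi x
  simp only [LinearMap.comp_apply (f := br), LinearMap.comp_apply (f := LinearMap.rTensor L br),
    hleft] at hj
  simp only [LinearMap.comp_apply, LinearMap.add_apply, LinearMap.id_apply, map_add,
    LinearMap.zero_apply, hcube, c23_c23_apply k L c hsym, c12_c12_apply k L c hsym,
    neg_eq_zero] at hj ⊢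
  rw [← hj]
  abel

end Rigidity
end
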